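/- arXiv:1711.05606 — 2 statements merged into one kernel-verified Lean document; each statement's English description precedes it below -/
import Mathlib

section
/- For all integers g ≥ 0 and n ≥ 1: N_g(n)·(4n−1)! = N×_g(n)·(2n−1)! and N_g(n)·(4n−1)! = N□_g(n)·(2n−1)!. Equivalently, rooted maps of genus g with n edges are equinumerous with rooted 4-valent bicolorable maps of genus g with n vertices, and with rooted bipartite quadrangulations of genus g with n faces. -/
/-- Number of cycles of a permutation, counting fixed points as cycles of length 1. -/
def cycCount {m : ℕ} (σ : Equiv.Perm (Fin m)) : ℕ :=
  σ.cycleType.card + (Finset.univ.filter fun x => σ x = x).card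

/-- The pair (σ, α) encodes a map: α is a fixed-point-free involution and ⟨σ, α⟩ acts
transitively on the darts. -/
def IsMapPair {m : ℕ} (σ α : Equiv.Perm (Fin m)) : Prop :=
  α * α = 1 ∧ (∀ d, α d ≠ d) ∧
    ∀ d d' : Fin m, ∃ g ∈ Subgroup.closure ({σ, α} : Set (Equiv.Perm (Fin m))), g d = d'

/-- `Nmaps g n` : number of pairs of permutations of the `2*n` darts encoding a rooted-map
class of genus `g` with `n` edges. -/
noncomputable def Nmaps (g n : ℕ) : ℕ :=
  Nat.card {p : Equiv.Perm (Fin (2 * n)) × Equiv.Perm (Fin (2 * n)) //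
    IsMapPair p.1 p.2 ∧
      (cycCount p.1 : ℤ) - (n : ℤ) + (cycCount (p.1 * p.2) : ℤ) = 2 - 2 * (g : ℤ)}

/-- `Nx g n` : number of pairs of permutations of the `4*n` darts encoding a `4`-valent
bicolorable map of genus `g` with `n` vertices. -/
noncomputable def Nx (g n : ℕ) : ℕ :=
  Nat.card {p : Equiv.Perm (Fin (4 * n)) × Equiv.Perm (Fin (4 * n)) //
    IsMapPair p.1 p.2 ∧
      p.1.cycleType = Multiset.replicate n 4 ∧
      (cycCount p.1 : ℤ) - 2 * (n : ℤ) + (cycCount (p.1 * p.2) : ℤ) = 2 - 2 * (g : ℤ) ∧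
      ∃ col : Fin (4 * n) → Bool,
        (∀ d, col (p.1 (p.2 d)) = col d) ∧ (∀ d, col (p.2 d) ≠ col d)}

/-- `Nsq g n` : number of pairs of permutations of the `4*n` darts encoding a bipartite
quadrangulation of genus `g` with `n` faces. -/
noncomputable def Nsq (g n : ℕ) : ℕ :=
  Nat.card {p : Equiv.Perm (Fin (4 * n)) × Equiv.Perm (Fin (4 * n)) //
    IsMapPair p.1 p.2 ∧
      (p.1 * p.2).cycleType = Multiset.replicate n 4 ∧
      (cycCount p.1 : ℤ) - 2 * (n : ℤ) + (cycCount (p.1 * p.2) : ℤ) = 2 - 2 * (g : ℤ) ∧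
      ∃ col : Fin (4 * n) → Bool,
        (∀ d, col (p.1 d) = col d) ∧ (∀ d, col (p.2 d) ≠ col d)}

open Equiv in
theorem cyc_sum {m k : ℕ} (t s : Perm (Fin m)) (e : Fin m ⊕ Fin m ≃ Fin k) :
    cycCount (e.permCongr (Perm.sumCongr t s)) = cycCount t + cycCount s := by
  classical
  have i1 : Function.Injective (fun a : Fin m => e (Sum.inl a)) := fun a b h => by simpa using h
  have i2 : Function.Injective (fun a : Fin m => e (Sum.inr a)) := fun a b h => by simpa using h
  let f1 := Equiv.ofInjective _ i1
  let f2 := Equiv.ofInjective _ i2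
  have a1 : ∀ a, t.extendDomain f1 (e (Sum.inl a)) = e (Sum.inl (t a)) := fun a =>
    Perm.extendDomain_apply_image t f1 a
  have a2 : ∀ a, s.extendDomain f2 (e (Sum.inr a)) = e (Sum.inr (s a)) := fun a =>
    Perm.extendDomain_apply_image s f2 a
  have b1 : ∀ a, t.extendDomain f1 (e (Sum.inr a)) = e (Sum.inr a) := fun a =>
    Perm.extendDomain_apply_not_subtype t f1 (by rintro ⟨b, hb⟩; simp at hb)
  have b2 : ∀ a, s.extendDomain f2 (e (Sum.inl a)) = e (Sum.inl a) := fun a =>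
    Perm.extendDomain_apply_not_subtype s f2 (by rintro ⟨b, hb⟩; simp at hb)
  have hp : e.permCongr (Perm.sumCongr t s) = t.extendDomain f1 * s.extendDomain f2 := by
    ext x
    obtain ⟨y, rfl⟩ := e.surjective x
    rcases y with a | a
    · simp [a1, b2]
    · simp [a2, b1]
  have hd : Perm.Disjoint (t.extendDomain f1) (s.extendDomain f2) := by
    intro x
    obtain ⟨y, rfl⟩ := e.surjective x
    rcases y with a | a
    · right; exact b2 a
    · left; exact b1 a
  have hc : (e.permCongr (Perm.sumCongr t s)).cycleType = t.cycleType + s.cycleType := by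
    rw [hp, hd.cycleType_mul, Perm.cycleType_extendDomain, Perm.cycleType_extendDomain]
  have hf : (Finset.univ.filter fun x => e.permCongr (Perm.sumCongr t s) x = x) =
      ((Finset.univ.filter fun x => t x = x).disjSum (Finset.univ.filter fun x => s x = x)).map
        e.toEmbedding := by
    ext x
    obtain ⟨y, rfl⟩ := e.surjective x
    rcases y with a | a <;> simp
  unfold cycCount
  rw [hc, hf, Finset.card_map, Finset.card_disjSum, Multiset.card_add]
  ring

theorem cyc_inv {m : ℕ} (t : Equiv.Perm (Fin m)) : cycCount t⁻¹ = cycCount t := by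
  unfold cycCount
  rw [Equiv.Perm.cycleType_inv]
  congr 2
  ext x
  simp only [Finset.mem_filter, Finset.mem_univ, true_and]
  rw [Equiv.Perm.inv_eq_iff_eq, eq_comm]

open Equiv in
theorem four_iff {n : ℕ} (σ : Perm (Fin (4 * n))) :
    σ.cycleType = Multiset.replicate n 4 ↔ σ ^ 4 = 1 ∧ ∀ x, σ (σ x) ≠ x := by
  constructor
  · intro h
    have hs : σ.support = Finset.univ := by
      rw [← Finset.card_eq_iff_eq_univ, ← Perm.sum_cycleType, h]
      simp [mul_comm]
    refine ⟨?_, ?_⟩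
    · rw [← orderOf_dvd_iff_pow_eq_one, ← Perm.lcm_cycleType, h, Multiset.lcm_dvd]
      intro b hb
      rw [Multiset.eq_of_mem_replicate hb]
    · intro x hx
      have hxs : x ∈ σ.support := by simp [hs]
      have hc : (σ.cycleOf x).IsCycle := Perm.isCycle_cycleOf σ (Perm.mem_support.1 hxs)
      have hm : (σ.cycleOf x).support.card ∈ σ.cycleType := by
        rw [Perm.cycleType_def, Multiset.mem_map]
        exact ⟨_, Perm.cycleOf_mem_cycleFactorsFinset_iff.2 hxs, rfl⟩
      rw [h] at hm
      have h4 := Multiset.eq_of_mem_replicate hm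
      have h2 : (σ.cycleOf x) ^ 2 = 1 := by
        rw [hc.pow_eq_one_iff]
        refine ⟨x, ?_, ?_⟩
        · rw [Perm.cycleOf_apply_self]; exact Perm.mem_support.1 hxs
        · rw [Perm.cycleOf_pow_apply_self, pow_two]; exact hx
      have := orderOf_dvd_of_pow_eq_one h2
      rw [hc.orderOf, h4] at this
      omega
  · rintro ⟨h4, h2⟩
    have hall : ∀ b ∈ σ.cycleType, b = 4 := by
      intro b hb
      have hd : b ∣ 4 := (Perm.dvd_of_mem_cycleType hb).trans (orderOf_dvd_of_pow_eq_one h4)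
      have hb2 := Perm.two_le_of_mem_cycleType hb
      have hle := Nat.le_of_dvd (by norm_num) hd
      have hne : b ≠ 2 := by
        rintro rfl
        rw [Perm.cycleType_def, Multiset.mem_map] at hb
        obtain ⟨c, hc, hc2⟩ := hb
        obtain ⟨hcy, hcs⟩ := Perm.mem_cycleFactorsFinset_iff.1 (Finset.mem_def.2 hc)
        have ho := hcy.orderOf
        obtain ⟨x, hx, -⟩ := id hcy
        have hx' : x ∈ c.support := Perm.mem_support.2 hx
        have e1 := hcs x hx'
        have e2 := hcs (c x) (Perm.apply_mem_support.2 hx')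
        apply h2 x
        rw [← e1, ← e2]
        have : c ^ 2 = 1 := by rw [← pow_orderOf_eq_one c, ho]; congr 1; exact hc2.symm
        simpa [pow_two] using congrArg (fun f : Perm _ => f x) this
      interval_cases b <;> omega
    have hr := Multiset.eq_replicate_card.2 hall
    have hs : σ.support = Finset.univ := by
      ext x
      simp only [Perm.mem_support, Finset.mem_univ, iff_true]
      intro hx
      exact h2 x (by rw [hx, hx])
    have := Perm.sum_cycleType σ
    rw [hs, hr] at this
    simp at this
    rw [hr]; congr 1; omega

/-- Transitivity. -/
def TrP {X : Type*} (σ α : Equiv.Perm X) : Prop :=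
  ∀ P : X → Prop, (∀ x, P (σ x) ↔ P x) → (∀ x, P (α x) ↔ P x) → ∀ x y, P x → P y

theorem tr_iff {X : Type*} (σ α : Equiv.Perm X) :
    (∀ d d' : X, ∃ g ∈ Subgroup.closure ({σ, α} : Set (Equiv.Perm X)), g d = d') ↔ TrP σ α := by
  constructor
  · intro h P h1 h2 x y hx
    obtain ⟨g, hg, rfl⟩ := h x y
    have : ∀ z, P (g z) ↔ P z := by
      induction hg using Subgroup.closure_induction with
      | mem g hg =>
        rcases hg with rfl | rfl
        · exact h1
        · exact h2
      | one => simp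
      | mul a b _ _ ha hb => intro z; simp [ha, hb]
      | inv a _ ha => intro z; rw [← ha]; simp
    exact (this x).2 hx
  · intro h d d'
    have key : ∀ τ ∈ Subgroup.closure ({σ, α} : Set (Equiv.Perm X)), ∀ x,
        (∃ g ∈ Subgroup.closure ({σ, α} : Set (Equiv.Perm X)), g d = τ x) ↔
        (∃ g ∈ Subgroup.closure ({σ, α} : Set (Equiv.Perm X)), g d = x) := by
      intro τ hτ x
      constructor
      · rintro ⟨g, hg, e⟩
        exact ⟨τ⁻¹ * g, mul_mem (inv_mem hτ) hg, by simp [e]⟩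
      · rintro ⟨g, hg, e⟩
        exact ⟨τ * g, mul_mem hτ hg, by simp [e]⟩
    exact h (fun y => ∃ g ∈ Subgroup.closure ({σ, α} : Set (Equiv.Perm X)), g d = y)
      (key σ (Subgroup.subset_closure (by simp))) (key α (Subgroup.subset_closure (by simp)))
      d d' ⟨1, one_mem _, rfl⟩

open Equiv in
/-- The standard quartic vertex permutation. -/
def stdS {A : Type*} (t s : Perm A) : Perm (A ⊕ A) := Perm.sumCongr t s * Equiv.sumComm A A

open Equiv in
theorem tr_std {A Y : Type*} (t s β : Perm A) (hβ : t * s = β) (e : A ⊕ A ≃ Y) :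
    TrP (e.permCongr (stdS t s)) (e.permCongr (Equiv.sumComm A A)) ↔ TrP s β := by
  subst hβ
  constructor
  · intro h P h1 h2 x y hx
    have ht : ∀ a, P (t a) ↔ P a := by
      intro a
      have := h2 (s.symm a)
      have h1' := h1 (s.symm a)
      simp at this h1'
      rw [this, ← h1']
    have := h (fun z => Sum.elim P P (e.symm z)) ?_ ?_ (e (Sum.inl x)) (e (Sum.inl y))
      (by simpa using hx)
    · simpa using this
    · intro z
      obtain ⟨w, rfl⟩ := e.surjective z
      rcases w with a | a <;> simp [stdS, ht, h1]
    · intro z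
      obtain ⟨w, rfl⟩ := e.surjective z
      rcases w with a | a <;> simp
  · intro h Q h1 h2 x y hx
    have hlr : ∀ a, Q (e (Sum.inr a)) ↔ Q (e (Sum.inl a)) := by
      intro a
      simpa using h2 (e (Sum.inl a))
    have hs : ∀ a, Q (e (Sum.inl (s a))) ↔ Q (e (Sum.inl a)) := by
      intro a
      rw [← hlr]
      simpa [stdS] using h1 (e (Sum.inl a))
    have ht : ∀ a, Q (e (Sum.inl (t a))) ↔ Q (e (Sum.inl a)) := by
      intro a
      rw [← hlr a]
      simpa [stdS] using h1 (e (Sum.inr a))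
    have hall := h (fun a => Q (e (Sum.inl a))) hs (by intro a; simp [ht, hs])
    have red : ∀ z, ∃ a, Q z ↔ Q (e (Sum.inl a)) := by
      intro z
      obtain ⟨w, rfl⟩ := e.surjective z
      rcases w with a | a
      · exact ⟨a, Iff.rfl⟩
      · exact ⟨a, hlr a⟩
    obtain ⟨a, ha⟩ := red x
    obtain ⟨b, hb⟩ := red y
    rw [hb]
    exact hall a b (ha.1 hx)

/-- Condition for maps. -/
def CM (g n : ℕ) (p : Equiv.Perm (Fin (2 * n)) × Equiv.Perm (Fin (2 * n))) : Prop :=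
    IsMapPair p.1 p.2 ∧
      (cycCount p.1 : ℤ) - (n : ℤ) + (cycCount (p.1 * p.2) : ℤ) = 2 - 2 * (g : ℤ)

/-- Condition for quartic maps. -/
def CX (g n : ℕ) (p : Equiv.Perm (Fin (4 * n)) × Equiv.Perm (Fin (4 * n))) : Prop :=
    IsMapPair p.1 p.2 ∧
      p.1.cycleType = Multiset.replicate n 4 ∧
      (cycCount p.1 : ℤ) - 2 * (n : ℤ) + (cycCount (p.1 * p.2) : ℤ) = 2 - 2 * (g : ℤ) ∧
      ∃ col : Fin (4 * n) → Bool,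
        (∀ d, col (p.1 (p.2 d)) = col d) ∧ (∀ d, col (p.2 d) ≠ col d)

theorem cyc_four {n : ℕ} (σ : Equiv.Perm (Fin (4 * n)))
    (h : σ.cycleType = Multiset.replicate n 4) : cycCount σ = n := by
  have h2 := ((four_iff σ).1 h).2
  unfold cycCount
  rw [h, Finset.filter_eq_empty_iff.2]
  · simp
  · intro x _ hx
    exact h2 x (by rw [hx, hx])

open Equiv in
theorem std_iff (g n : ℕ) (t s β : Perm (Fin (2 * n))) (hβ : t * s = β)
    (e : Fin (2 * n) ⊕ Fin (2 * n) ≃ Fin (4 * n)) :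
    CX g n (e.permCongr (stdS t s), e.permCongr (Equiv.sumComm _ _)) ↔ CM g n (s, β) := by
  have h4 : (e.permCongr (stdS t s)).cycleType = Multiset.replicate n 4 ↔
      β * β = 1 ∧ ∀ d, β d ≠ d := by
    subst hβ
    rw [four_iff]
    constructor
    · rintro ⟨h1, h2⟩
      constructor
      · ext a
        have := congrArg (fun f : Perm _ => f (e (Sum.inl a))) h1
        simp [stdS, pow_succ] at this
        simp [this]
      · intro a ha
        apply h2 (e (Sum.inl a))
        simpa [stdS] using ha
    · rintro ⟨h1, h2⟩
      have h1' : ∀ a, t (s (t (s a))) = a := fun a => by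
        simpa using congrArg (fun f : Perm _ => f a) h1
      have h1'' : ∀ a, s (t (s (t a))) = a := fun a => by
        apply t.injective
        have := h1' (s.symm (t.symm (t (t.symm (t a)))))
        have := h1' (s.symm a)
        obtain ⟨b, rfl⟩ := s.surjective a
        rw [h1']
      constructor
      · ext x
        obtain ⟨y, rfl⟩ := e.surjective x
        rcases y with a | a
        · simp [stdS, pow_succ, h1']
        · simp [stdS, pow_succ, h1'']
      · intro x
        obtain ⟨y, rfl⟩ := e.surjective x
        rcases y with a | a
        · simpa [stdS] using h2 a
        · intro hx
          simp [stdS] at hx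
          exact h2 (t a) (by simp [hx])
  have hprod : e.permCongr (stdS t s) * e.permCongr (Equiv.sumComm _ _) =
      e.permCongr (Perm.sumCongr t s) := by
    ext x
    obtain ⟨y, rfl⟩ := e.surjective x
    rcases y with a | a <;> simp [stdS]
  have hcol : ∃ col : Fin (4 * n) → Bool,
        (∀ d, col (e.permCongr (stdS t s) (e.permCongr (Equiv.sumComm _ _) d)) = col d) ∧
        (∀ d, col (e.permCongr (Equiv.sumComm _ _) d) ≠ col d) := by
    refine ⟨fun x => (e.symm x).isLeft, ?_, ?_⟩
    · intro x
      obtain ⟨y, rfl⟩ := e.surjective x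
      rcases y with a | a <;> simp [stdS]
    · intro x
      obtain ⟨y, rfl⟩ := e.surjective x
      rcases y with a | a <;> simp
  have hinv : e.permCongr (Equiv.sumComm _ _) * e.permCongr (Equiv.sumComm _ _) = 1 := by
    ext x
    obtain ⟨y, rfl⟩ := e.surjective x
    rcases y with a | a <;> simp
  have hfpf : ∀ d, e.permCongr (Equiv.sumComm _ _) d ≠ d := by
    intro x
    obtain ⟨y, rfl⟩ := e.surjective x
    rcases y with a | a <;> simp
  unfold CX CM IsMapPair
  simp only [tr_iff, tr_std t s β hβ e, hprod, cyc_sum]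
  constructor
  · rintro ⟨⟨-, -, ht⟩, hc, he, -⟩
    obtain ⟨k1, k2⟩ := h4.1 hc
    refine ⟨⟨k1, k2, ht⟩, ?_⟩
    rw [cyc_four _ hc] at he
    have : s * β = t⁻¹ := by
      rw [eq_inv_iff_mul_eq_one]
      subst hβ
      have : t * (s * (t * s) * t) * t⁻¹ = 1 := by rw [← k1]; group
      rw [mul_inv_eq_one] at this
      simpa using this
    rw [this, cyc_inv]
    push_cast at he
    linarith
  · rintro ⟨⟨k1, k2, ht⟩, he⟩
    have hc := h4.2 ⟨k1, k2⟩
    refine ⟨⟨hinv, hfpf, ht⟩, hc, ?_, hcol⟩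
    have : s * β = t⁻¹ := by
      rw [eq_inv_iff_mul_eq_one]
      subst hβ
      have : t * (s * (t * s) * t) * t⁻¹ = 1 := by rw [← k1]; group
      rw [mul_inv_eq_one] at this
      simpa using this
    rw [this, cyc_inv] at he
    rw [cyc_four _ hc]
    push_cast
    linarith

open Equiv in
/-- Compatibility of a labelling with a quartic map. -/
def Cmp {n : ℕ} (p : Perm (Fin (4 * n)) × Perm (Fin (4 * n)))
    (e : Fin (2 * n) ⊕ Fin (2 * n) ≃ Fin (4 * n)) : Prop :=
  (∀ a, p.2 (e (Sum.inl a)) = e (Sum.inr a)) ∧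
    ∀ d, (e.symm (p.1 (p.2 d))).isLeft = (e.symm d).isLeft

open Equiv in
theorem fiber_card {g n : ℕ} (p : Perm (Fin (4 * n)) × Perm (Fin (4 * n))) (hp : CX g n p)
    (hn : 1 ≤ n) :
    Nat.card {e : Fin (2 * n) ⊕ Fin (2 * n) ≃ Fin (4 * n) // Cmp p e} =
      2 * Nat.factorial (2 * n) := by
  classical
  obtain ⟨σ, α⟩ := p
  obtain ⟨⟨hinv, -, htr⟩, -, -, col, hc1, hc2⟩ := hp
  rw [tr_iff] at htr
  dsimp only at *
  have hinv' : ∀ d, α (α d) = d := fun d => by simpa using congrArg (fun f : Perm _ => f d) hinv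
  have hα : ∀ d, col (α d) = !col d := fun d => by
    have := hc2 d
    revert this; cases col (α d) <;> cases col d <;> simp
  have hσ : ∀ d, col (σ d) = !col d := fun d => by
    have := hc1 (α d)
    rw [hinv', hα] at this; exact this
  -- sizes of colour classes
  have hsz : ∀ b, Fintype.card {d // col d = b} = 2 * n := by
    have e1 : Fintype.card {d // col d = true} = Fintype.card {d // col d = false} := by
      apply Fintype.card_congr
      exact α.subtypeEquiv (fun d => by rw [hα]; simp)
    have e2 : Fintype.card {d // col d = true} + Fintype.card {d // ¬ col d = true} = 4 * n := by
      rw [Fintype.card_subtype_compl]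
      have := Fintype.card_subtype_le (fun d => col d = true)
      simp at this ⊢
      omega
    simp only [Bool.not_eq_true] at e2
    intro b
    cases b <;> omega
  have a0 : Fin (2 * n) := ⟨0, by omega⟩
  -- a compatible labelling is coloured uniformly
  have hal : ∀ e, Cmp (σ, α) e → ∀ a, α (e (Sum.inr a)) = e (Sum.inl a) := by
    intro e he a
    rw [← he.1 a]; exact hinv' _
  have hun : ∀ e, Cmp (σ, α) e → ∀ a a', col (e (Sum.inl a)) = col (e (Sum.inl a')) := by
    intro e he a a'
    have hL : ∀ d, (e.symm (α d)).isLeft = !(e.symm d).isLeft := by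
      intro d
      obtain ⟨y, rfl⟩ := e.surjective d
      rcases y with a | a
      · have := he.1 a
        dsimp at this
        rw [this]; simp
      · rw [hal e he]; simp
    have hS : ∀ d, (e.symm (σ d)).isLeft = !(e.symm d).isLeft := by
      intro d
      have := he.2 (α d)
      dsimp at this
      rw [hinv', hL] at this
      exact this
    have := htr (fun d => (e.symm d).isLeft = (col d == col (e (Sum.inl a)))) ?_ ?_
      (e (Sum.inl a)) (e (Sum.inl a')) (by simp)
    · simp at this
      exact this.symm
    · intro d
      simp only [hS, hσ]
      cases (e.symm d).isLeft <;> cases col d <;> cases col (e (Sum.inl a)) <;> simp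
    · intro d
      simp only [hL, hα]
      cases (e.symm d).isLeft <;> cases col d <;> cases col (e (Sum.inl a)) <;> simp
  let F : {e : Fin (2 * n) ⊕ Fin (2 * n) ≃ Fin (4 * n) // Cmp (σ, α) e} →
      Σ b : Bool, (Fin (2 * n) ↪ {d // col d = b}) := fun e =>
    ⟨col (e.1 (Sum.inl a0)), ⟨fun a => ⟨e.1 (Sum.inl a), hun e.1 e.2 a a0⟩, fun a a' h => by
      simpa using h⟩⟩
  have hext : ∀ z w : Σ b : Bool, (Fin (2 * n) ↪ {d // col d = b}), z.1 = w.1 →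
      (∀ a, (z.2 a).1 = (w.2 a).1) → z = w := by
    rintro ⟨b, f⟩ ⟨b', f'⟩ h h2
    dsimp only at h
    subst h
    congr 1
    ext a : 1
    exact Subtype.ext (h2 a)
  have hF : Function.Bijective F := by
    constructor
    · rintro ⟨e, he⟩ ⟨e', he'⟩ h
      have h' : ∀ a, e (Sum.inl a) = e' (Sum.inl a) := by
        intro a
        have := congrArg (fun z : Σ b : Bool, (Fin (2 * n) ↪ {d // col d = b}) =>
          (z.2 a : Fin (4 * n))) h
        exact this
      apply Subtype.ext
      apply Equiv.ext
      rintro (a | a)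
      · exact h' a
      · have h1 := he.1 a
        have h2 := he'.1 a
        dsimp at h1 h2 ⊢
        rw [← h1, ← h2, h' a]
    · rintro ⟨b, f⟩
      have hinj : Function.Injective (Sum.elim (fun a => (f a : Fin (4 * n)))
          (fun a => α (f a))) := by
        rintro (a | a) (a' | a') h
        · simp only [Sum.elim_inl] at h
          rw [f.injective (Subtype.ext h)]
        · exfalso
          have := congrArg col h
          simp only [Sum.elim_inl, Sum.elim_inr, hα, (f a).2, (f a').2] at this
          cases b <;> simp at this
        · exfalso
          have := congrArg col h
          simp only [Sum.elim_inl, Sum.elim_inr, hα, (f a).2, (f a').2] at this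
          cases b <;> simp at this
        · simp only [Sum.elim_inr] at h
          rw [f.injective (Subtype.ext (α.injective h))]
      have hbij := (Fintype.bijective_iff_injective_and_card _).2 ⟨hinj, by simp; omega⟩
      let e := Equiv.ofBijective _ hbij
      have el : ∀ a, e (Sum.inl a) = f a := fun a => rfl
      have er : ∀ a, e (Sum.inr a) = α (f a) := fun a => rfl
      have hL : ∀ d, (e.symm d).isLeft = (col d == b) := by
        intro d
        obtain ⟨y, rfl⟩ := e.surjective d
        rcases y with a | a
        · rw [Equiv.symm_apply_apply, el, (f a).2]; simp
        · rw [Equiv.symm_apply_apply, er, hα, (f a).2]; cases b <;> rfl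
      have he : Cmp (σ, α) e := by
        refine ⟨fun a => ?_, fun d => ?_⟩
        · rw [el, er]
        · rw [hL, hL]; dsimp; rw [hc1]
      refine ⟨⟨e, he⟩, ?_⟩
      have hb : col (e (Sum.inl a0)) = b := by rw [el]; exact (f a0).2
      exact hext _ _ hb (fun a => rfl)
  rw [Nat.card_congr (Equiv.ofBijective F hF), Nat.card_sigma]
  simp only [Nat.card_eq_fintype_card, Fintype.card_embedding_eq, hsz, Fintype.card_fin,
    Nat.descFactorial_self, Finset.sum_const, Finset.card_univ, Fintype.card_bool, smul_eq_mul]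

open Equiv in
theorem main_count (g n : ℕ) (hn : 1 ≤ n) :
    Nat.card {p // CM g n p} * Nat.factorial (4 * n) =
      Nat.card {p // CX g n p} * (2 * Nat.factorial (2 * n)) := by
  classical
  let E := Fin (2 * n) ⊕ Fin (2 * n) ≃ Fin (4 * n)
  have hE : Nat.card E = Nat.factorial (4 * n) := by
    have e0 : E := Fintype.equivOfCardEq (by simp; omega)
    rw [Nat.card_eq_fintype_card, Fintype.card_equiv e0]
    congr 1
    simp; omega
  have hR : Nat.card (Σ p : {p // CX g n p}, {e : E // Cmp p.1 e}) =
      Nat.card {p // CX g n p} * (2 * Nat.factorial (2 * n)) := by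
    rw [Nat.card_sigma, Finset.sum_congr rfl (fun p _ => fiber_card p.1 p.2 hn)]
    simp [Nat.card_eq_fintype_card]
  rw [← hR, ← hE, ← Nat.card_prod]
  have hst : ∀ s β : Perm (Fin (2 * n)), β * s⁻¹ * s = β := fun s β => by simp
  let G : {p // CM g n p} × E → Σ p : {p // CX g n p}, {e : E // Cmp p.1 e} := fun x =>
    ⟨⟨(x.2.permCongr (stdS (x.1.1.2 * x.1.1.1⁻¹) x.1.1.1), x.2.permCongr (Equiv.sumComm _ _)),
      (std_iff g n _ _ _ (hst _ _) x.2).2 x.1.2⟩, ⟨x.2, by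
        constructor
        · intro a; simp
        · intro d
          obtain ⟨y, rfl⟩ := x.2.surjective d
          rcases y with a | a <;> simp [stdS]⟩⟩
  have hext : ∀ z w : Σ p : {p // CX g n p}, {e : E // Cmp p.1 e}, z.1.1 = w.1.1 →
      z.2.1 = w.2.1 → z = w := by
    rintro ⟨⟨p, hp⟩, ⟨e, he⟩⟩ ⟨⟨p', hp'⟩, ⟨e', he'⟩⟩ h h2
    dsimp only at h h2
    subst h
    subst h2
    rfl
  apply Nat.card_congr
  apply Equiv.ofBijective G
  constructor
  · rintro ⟨⟨⟨s, β⟩, h⟩, e⟩ ⟨⟨⟨s', β'⟩, h'⟩, e'⟩ hG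
    have he : e = e' := congrArg
      (fun z : Σ p : {p // CX g n p}, {e : E // Cmp p.1 e} => z.2.1) hG
    subst he
    have hσ : e.permCongr (stdS (β * s⁻¹) s) = e.permCongr (stdS (β' * s'⁻¹) s') := congrArg
      (fun z : Σ p : {p // CX g n p}, {e : E // Cmp p.1 e} => z.1.1.1) hG
    have hσ' := e.permCongr.injective hσ
    unfold stdS at hσ'
    have h3 := mul_right_cancel hσ'
    have h4 := Perm.sumCongrHom_injective (a₁ := (β * s⁻¹, s)) (a₂ := (β' * s'⁻¹, s')) h3
    obtain ⟨h5, rfl⟩ := Prod.mk.inj h4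
    have := mul_right_cancel h5
    subst this
    rfl
  · rintro ⟨⟨⟨σ, α⟩, hx⟩, ⟨e, he⟩⟩
    have hinv : ∀ d, α (α d) = d := fun d => by
      simpa using congrArg (fun f : Perm _ => f d) hx.1.1
    have hα : e.permCongr (Equiv.sumComm _ _) = α := by
      ext x
      obtain ⟨y, rfl⟩ := e.surjective x
      rcases y with a | a
      · have := he.1 a
        dsimp at this
        simp [this]
      · have := he.1 a
        dsimp at this
        rw [← this, hinv, this]; simp
    have hm := Perm.mem_sumCongrHom_range_of_perm_mapsTo_inl
      (σ := e.symm.permCongr (σ * α)) (by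
        rintro _ ⟨a, rfl⟩
        have h0 := he.2 (e (Sum.inl a))
        rw [Equiv.symm_apply_apply] at h0
        have : (e.symm (σ (α (e (Sum.inl a))))).isLeft = true := h0
        rw [Sum.isLeft_iff] at this
        obtain ⟨y, hy⟩ := this
        exact ⟨y, by simp [hy]⟩)
    obtain ⟨⟨t, s⟩, hts⟩ := hm
    have hts' : Perm.sumCongr t s = e.symm.permCongr (σ * α) := hts
    have hσ : e.permCongr (stdS t s) = σ := by
      unfold stdS
      rw [hts']
      ext x
      have := congrArg (fun f : Perm _ => f x) hα
      simp at this
      simp [this, hinv]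
    subst hσ
    subst hα
    have hM := (std_iff g n t s _ rfl e).1 hx
    refine ⟨⟨⟨(s, t * s), hM⟩, e⟩, ?_⟩
    have hh : t * s * s⁻¹ = t := by simp
    apply hext
    · simp only [G, hh]
    · rfl

theorem nx_eq_nsq (g n : ℕ) : Nx g n = Nsq g n := by
  unfold Nx Nsq
  have htr : ∀ m (σ α : Equiv.Perm (Fin m)), IsMapPair σ α → IsMapPair (σ * α) α := by
    rintro m σ α ⟨h1, h2, h3⟩
    refine ⟨h1, h2, ?_⟩
    rw [tr_iff] at h3 ⊢
    intro P k1 k2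
    refine h3 P (fun x => ?_) k2
    have h1' : α (α x) = x := by simpa using congrArg (fun f : Equiv.Perm _ => f x) h1
    have := k1 (α x)
    rw [k2, Equiv.Perm.mul_apply, h1'] at this
    exact this
  have hh : ∀ m (σ α : Equiv.Perm (Fin m)), IsMapPair σ α → σ * α * α = σ := by
    rintro m σ α ⟨h1, -⟩
    rw [mul_assoc, h1, mul_one]
  have hi : ∀ m (σ α : Equiv.Perm (Fin m)), IsMapPair σ α → ∀ x, α (α x) = x := by
    rintro m σ α ⟨h1, -⟩ x
    simpa using congrArg (fun f : Equiv.Perm _ => f x) h1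
  apply Nat.card_congr
  refine ⟨fun p => ⟨(p.1.1 * p.1.2, p.1.2), ?_⟩, fun p => ⟨(p.1.1 * p.1.2, p.1.2), ?_⟩, ?_, ?_⟩
  · obtain ⟨⟨σ, α⟩, h, h4, he, col, c1, c2⟩ := p
    dsimp only at *
    rw [hh _ _ _ h]
    exact ⟨htr _ _ _ h, h4, by linarith, col, c1, c2⟩
  · obtain ⟨⟨σ, α⟩, h, h4, he, col, c1, c2⟩ := p
    dsimp only at *
    rw [hh _ _ _ h]
    refine ⟨htr _ _ _ h, h4, by linarith, col, fun d => ?_, c2⟩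
    rw [Equiv.Perm.mul_apply, hi _ _ _ h, c1]
  · rintro ⟨⟨σ, α⟩, h, h'⟩
    apply Subtype.ext
    dsimp only at *
    rw [hh _ _ _ h]
  · rintro ⟨⟨σ, α⟩, h, h'⟩
    apply Subtype.ext
    dsimp only at *
    rw [hh _ _ _ h]

theorem maps_equinumerous_with_quartic_maps (g n : ℕ) (hn : 1 ≤ n) :
    Nmaps g n * Nat.factorial (4 * n - 1) = Nx g n * Nat.factorial (2 * n - 1) ∧
    Nmaps g n * Nat.factorial (4 * n - 1) = Nsq g n * Nat.factorial (2 * n - 1) := by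
  rw [← nx_eq_nsq, and_self]
  have h := main_count g n hn
  change Nmaps g n * Nat.factorial (4 * n) = Nx g n * (2 * Nat.factorial (2 * n)) at h
  rw [← Nat.mul_factorial_pred (n := 4 * n) (by omega),
    ← Nat.mul_factorial_pred (n := 2 * n) (by omega)] at h
  have h4 : 0 < 4 * n := by omega
  apply Nat.eq_of_mul_eq_mul_left h4
  linarith
end

section
/- Let n ≥ 1, let e be a connected edge-weighted graph on Fin n, and let m be offset data on Fin n. In the field ℚ(X) of rational functions (RatFunc ℚ), define F := Σ over all surjections o with domain Fin n of ( Π_{i=1}^{k(o)−1} X^{C(o⁻¹({0,…,i−1}))} / (1 − X^{C(o⁻¹({0,…,i−1}))}) ) · X^{−w(o)}; by connectivity each exponent C(o⁻¹({0,…,i−1})) is positive, so each factor is a well-defined element of ℚ(X). Let ι be the unique ℚ-algebra field homomorphism of ℚ(X) with ι(X) = X⁻¹. Then ι(F) = (−1)^{n−1}·F. (This is the symmetry in D, for each fixed unlabeled scheme with n scheme vertices, underlying the theorem that the generating series R^b_s of scheme-rooted pruned well-labeled well-oriented blossoming unicellular maps with unlabeled scheme s is rational and symmetric in D.) -/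
open scoped Classical

/-- A surjection of size `n`: a surjective function from `Fin n` onto some `Fin k`. -/
abbrev Surjs (n : ℕ) : Type :=
  {o : Σ k : Fin (n + 1), Fin n → Fin (k : ℕ) // Function.Surjective o.2}

namespace Surjs

variable {n : ℕ}

/-- The size `k(o)` of the image of the surjection. -/
def k (o : Surjs n) : ℕ := (o.1.1 : ℕ)

/-- The underlying function of the surjection. -/
def f (o : Surjs n) : Fin n → Fin o.k := o.1.2

end Surjs

/-- For offset data `m` (multiplicity of offset edges from `i` to `j`, for `i < j`),
`wgt m o = Σ_{i<j} m i j · ε_o(i,j)` where `ε_o(i,j) = 1` if `o i > o j` and `-1`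
otherwise. -/
def wgt {n : ℕ} (m : Fin n → Fin n → ℕ) (o : Surjs n) : ℤ :=
  ∑ i : Fin n, ∑ j : Fin n,
    if i < j then (m i j : ℤ) * (if o.f j < o.f i then 1 else -1) else 0

/-- The cut `C(S)` of a subset `S` of vertices in the edge-weighted graph `e`:
total multiplicity of the edges with exactly one endpoint in `S`. -/
def cut {n : ℕ} (e : Fin n → Fin n → ℕ) (S : Finset (Fin n)) : ℕ :=
  ∑ a ∈ S, ∑ b ∈ Sᶜ, e a b

/-- The edge-weighted graph `e` is connected: every nonempty proper subset of vertices is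
crossed by an edge of positive multiplicity. -/
def GraphConnected {n : ℕ} (e : Fin n → Fin n → ℕ) : Prop :=
  ∀ S : Finset (Fin n), S.Nonempty → S ≠ Finset.univ →
    ∃ a ∈ S, ∃ b ∈ Sᶜ, 0 < e a b

/-- `o⁻¹({0, …, i})`, the union of the first `i+1` classes of the surjection `o`. -/
def lowSet {n : ℕ} (o : Surjs n) (i : ℕ) : Finset (Fin n) :=
  Finset.univ.filter fun x => (o.f x : ℕ) ≤ i

namespace SchemeAux

variable {N : ℕ}

theorem surj_ext {n : ℕ} (o o' : Surjs n) (hk : o.k = o'.k)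
    (h : ∀ x, (o.f x : ℕ) = (o'.f x : ℕ)) : o = o' := by
  obtain ⟨⟨⟨k, hk1⟩, f⟩, hf⟩ := o
  obtain ⟨⟨⟨k', hk1'⟩, f'⟩, hf'⟩ := o'
  simp only [Surjs.k] at hk
  subst hk
  have : f = f' := by
    funext x
    exact Fin.ext (h x)
  subst this
  rfl

/-- number of cuts before position `i` -/
def cnt (D : Finset (Fin N)) (i : Fin (N + 1)) : ℕ :=
  (D.filter fun d => d.castSucc < i).card

theorem cnt_zero (D : Finset (Fin N)) : cnt D 0 = 0 := by
  simp [cnt]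

theorem cnt_succ (D : Finset (Fin N)) (i : Fin N) :
    cnt D i.succ = cnt D i.castSucc + if i ∈ D then 1 else 0 := by
  unfold cnt
  split_ifs with h
  · have : (D.filter fun d => d.castSucc < i.succ)
        = insert i (D.filter fun d => d.castSucc < i.castSucc) := by
      ext d
      simp only [Finset.mem_filter, Finset.mem_insert, Fin.lt_def, Fin.ext_iff, Fin.val_castSucc,
        Fin.val_succ]
      constructor
      · rintro ⟨h1, h2⟩
        by_cases h3 : (d : ℕ) = i
        · exact Or.inl h3
        · exact Or.inr ⟨h1, by omega⟩
      · rintro (h1 | ⟨h1, h2⟩)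
        · have : d = i := Fin.ext h1
          subst this
          exact ⟨h, by omega⟩
        · exact ⟨h1, by omega⟩
    rw [this, Finset.card_insert_of_notMem (by simp)]
  · congr 1
    ext d
    simp only [Finset.mem_filter, Fin.lt_def, Fin.val_castSucc, Fin.val_succ]
    constructor
    · rintro ⟨h1, h2⟩
      refine ⟨h1, ?_⟩
      have : (d : ℕ) ≠ i := fun h3 => h (by rw [← Fin.ext h3]; exact h1)
      omega
    · rintro ⟨h1, h2⟩
      exact ⟨h1, by omega⟩

theorem cnt_last (D : Finset (Fin N)) : cnt D (Fin.last N) = D.card := by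
  unfold cnt
  congr 1
  rw [Finset.filter_true_of_mem]
  intro d _
  exact Fin.castSucc_lt_last d

theorem cnt_mono (D : Finset (Fin N)) : Monotone (cnt D) := by
  intro i j hij
  apply Finset.card_le_card
  intro d
  simp only [Finset.mem_filter]
  exact fun h => ⟨h.1, lt_of_lt_of_le h.2 hij⟩

theorem cnt_surj (D : Finset (Fin N)) (t : ℕ) (i : Fin (N + 1)) :
    t ≤ cnt D i → ∃ j, cnt D j = t := by
  induction i using Fin.induction with
  | zero => intro h; exact ⟨0, by rw [cnt_zero] at *; omega⟩
  | succ i ih =>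
    intro h
    by_cases h2 : t ≤ cnt D i.castSucc
    · exact ih h2
    · refine ⟨i.succ, ?_⟩
      have := cnt_succ D i
      split_ifs at this <;> omega

/-- the sorting permutation -/
noncomputable def srt (o : Surjs (N + 1)) : Equiv.Perm (Fin (N + 1)) := Tuple.sort o.f

noncomputable def cuts (o : Surjs (N + 1)) : Finset (Fin N) :=
  Finset.univ.filter fun i => o.f (srt o i.castSucc) < o.f (srt o i.succ)

theorem srt_mono (o : Surjs (N + 1)) : Monotone (o.f ∘ srt o) := Tuple.monotone_sort _

theorem surj_f {n : ℕ} (o : Surjs n) : Function.Surjective o.f := o.2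

theorem f_srt (o : Surjs (N + 1)) (i : Fin (N + 1)) :
    (o.f (srt o i) : ℕ) = cnt (cuts o) i := by
  have hm := srt_mono o
  have hs : Function.Surjective (o.f ∘ srt o) := (surj_f o).comp (srt o).surjective
  induction i using Fin.induction with
  | zero =>
    rw [cnt_zero]
    obtain ⟨j, hj⟩ := hs ⟨0, (o.f 0).pos⟩
    have := hm (Fin.zero_le j)
    rw [hj] at this
    simpa [Fin.le_def] using this
  | succ i ih =>
    rw [cnt_succ, ← ih]
    have h1 : (o.f (srt o i.castSucc) : ℕ) ≤ o.f (srt o i.succ) :=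
      hm (Fin.castSucc_lt_succ (i := i)).le
    have hc : i ∈ cuts o ↔ (o.f (srt o i.castSucc) : ℕ) < o.f (srt o i.succ) := by
      simp [cuts]
    rw [if_congr hc rfl rfl]
    split_ifs with h
    · by_contra hne
      have hlt := (o.f (srt o i.succ)).isLt
      obtain ⟨j, hj⟩ := hs ⟨(o.f (srt o i.castSucc) : ℕ) + 1, by omega⟩
      have hj' : (o.f (srt o j) : ℕ) = (o.f (srt o i.castSucc) : ℕ) + 1 := congrArg Fin.val hj
      rcases le_or_gt j i.castSucc with hji | hji
      · have : (o.f (srt o j) : ℕ) ≤ o.f (srt o i.castSucc) := hm hji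
        omega
      · have h3 : i.succ ≤ j := Fin.castSucc_lt_iff_succ_le.mp hji
        have : (o.f (srt o i.succ) : ℕ) ≤ o.f (srt o j) := hm h3
        omega
    · omega

theorem k_eq (o : Surjs (N + 1)) : o.k = (cuts o).card + 1 := by
  have hm := srt_mono o
  have hs : Function.Surjective (o.f ∘ srt o) := (surj_f o).comp (srt o).surjective
  have hpos : 0 < o.k := (o.f 0).pos
  obtain ⟨j, hj⟩ := hs ⟨o.k - 1, by omega⟩
  have hj' : (o.f (srt o j) : ℕ) = o.k - 1 := congrArg Fin.val hj
  have h1 : (o.f (srt o j) : ℕ) ≤ o.f (srt o (Fin.last N)) := hm (Fin.le_last j)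
  have h2 := (o.f (srt o (Fin.last N))).isLt
  have h3 := f_srt o (Fin.last N)
  rw [cnt_last] at h3
  omega

/-- descents -/
def Desc (σ : Equiv.Perm (Fin (N + 1))) (i : Fin N) : Prop := σ i.succ < σ i.castSucc

/-- first elements -/
def low (σ : Equiv.Perm (Fin (N + 1))) (i : Fin N) : Finset (Fin (N + 1)) :=
  Finset.univ.filter fun x => σ.symm x ≤ i.castSucc

def pw (m : Fin (N + 1) → Fin (N + 1) → ℕ) (σ : Equiv.Perm (Fin (N + 1))) : ℤ :=
  ∑ i, ∑ j, if i < j then (m i j : ℤ) * (if σ.symm j < σ.symm i then 1 else -1) else 0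

theorem srt_spec (o : Surjs (N + 1)) {i j : Fin (N + 1)} (hij : i < j)
    (h : o.f (srt o i) = o.f (srt o j)) : srt o i < srt o j :=
  (Tuple.eq_sort_iff.mp (rfl : srt o = Tuple.sort o.f)).2 i j hij h

theorem desc_cuts (o : Surjs (N + 1)) (i : Fin N) (h : Desc (srt o) i) : i ∈ cuts o := by
  simp only [cuts, Finset.mem_filter, Finset.mem_univ, true_and]
  by_contra hc
  have h1 : o.f (srt o i.castSucc) ≤ o.f (srt o i.succ) :=
    srt_mono o (Fin.castSucc_lt_succ (i := i)).le
  have := srt_spec o (Fin.castSucc_lt_succ (i := i)) (le_antisymm h1 (not_lt.mp hc))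
  exact absurd h this.asymm

theorem wgt_eq (m : Fin (N + 1) → Fin (N + 1) → ℕ) (o : Surjs (N + 1)) :
    wgt m o = pw m (srt o) := by
  unfold wgt pw
  refine Finset.sum_congr rfl fun i _ => Finset.sum_congr rfl fun j _ => ?_
  by_cases hij : i < j
  · rw [if_pos hij, if_pos hij]
    congr 1
    refine if_congr ?_ rfl rfl
    constructor
    · intro h
      by_contra hc
      have := srt_mono o (not_lt.mp hc)
      simp only [Function.comp, Equiv.apply_symm_apply] at this
      exact absurd h this.not_gt
    · intro h
      have h1 := srt_mono o h.le
      simp only [Function.comp, Equiv.apply_symm_apply] at h1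
      refine lt_of_le_of_ne h1 fun he => ?_
      have := srt_spec o h (by simpa using he)
      simp only [Equiv.apply_symm_apply] at this
      exact absurd hij this.asymm
  · rw [if_neg hij, if_neg hij]

theorem prod_eq (o : Surjs (N + 1)) (g : Finset (Fin (N + 1)) → RatFunc ℚ) :
    ∏ i ∈ Finset.range (o.k - 1), g (lowSet o i) = ∏ d ∈ cuts o, g (low (srt o) d) := by
  symm
  have hlt : ∀ d ∈ cuts o, cnt (cuts o) d.succ = cnt (cuts o) d.castSucc + 1 := by
    intro d hd
    rw [cnt_succ, if_pos hd]
  have hmaps : ∀ d ∈ cuts o, cnt (cuts o) d.castSucc ∈ Finset.range (o.k - 1) := by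
    intro d hd
    have := hlt d hd
    have h2 := cnt_mono (cuts o) (Fin.le_last d.succ)
    rw [cnt_last] at h2
    rw [k_eq, Finset.mem_range]
    omega
  have hinj : Set.InjOn (fun d : Fin N => cnt (cuts o) d.castSucc) (cuts o) := by
    have key : ∀ d ∈ cuts o, ∀ d' : Fin N, d < d' →
        cnt (cuts o) d.castSucc < cnt (cuts o) d'.castSucc := by
      intro d hd d' hdd
      have := hlt d hd
      have h2 := cnt_mono (cuts o) (show d.succ ≤ d'.castSucc by
        rw [Fin.le_def]; simp; exact hdd)
      omega
    intro d hd d' hd' h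
    simp only at h
    rcases lt_trichotomy d d' with h1 | h1 | h1
    · have := key d hd d' h1; omega
    · exact h1
    · have := key d' hd' d h1; omega
  refine Finset.prod_nbij (fun d => cnt (cuts o) d.castSucc) hmaps hinj ?_ ?_
  · have : (cuts o).image (fun d => cnt (cuts o) d.castSucc) = Finset.range (o.k - 1) := by
      apply Finset.eq_of_subset_of_card_le
      · intro x hx
        obtain ⟨d, hd, rfl⟩ := Finset.mem_image.mp hx
        exact hmaps d hd
      · rw [Finset.card_image_of_injOn hinj, k_eq]
        simp
    intro x hx
    rw [← this] at hx
    simpa using hx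
  · intro d hd
    congr 1
    ext x
    simp only [low, lowSet, Finset.mem_filter, Finset.mem_univ, true_and]
    have hx := f_srt o ((srt o).symm x)
    rw [Equiv.apply_symm_apply] at hx
    rw [hx]
    constructor
    · intro h
      exact cnt_mono _ h
    · intro h
      by_contra hc
      have h3 : d.succ ≤ (srt o).symm x := Fin.castSucc_lt_iff_succ_le.mp (not_le.mp hc)
      have := cnt_mono (cuts o) h3
      have := hlt d hd
      omega

/-- the surjection attached to a permutation and a set of cuts -/
def mk (σ : Equiv.Perm (Fin (N + 1))) (D : Finset (Fin N)) : Surjs (N + 1) :=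
  ⟨⟨⟨D.card + 1, by have := D.card_le_univ; simp at this; omega⟩,
    fun x => ⟨cnt D (σ.symm x), by
      have := cnt_mono D (Fin.le_last (σ.symm x))
      rw [cnt_last] at this
      exact Nat.lt_succ_of_le this⟩⟩, by
    rintro ⟨t, ht⟩
    obtain ⟨j, hj⟩ := cnt_surj D t (Fin.last N) (by rw [cnt_last]; exact Nat.le_of_lt_succ ht)
    refine ⟨σ j, ?_⟩
    apply Fin.ext
    simpa using hj⟩

theorem mk_f (σ : Equiv.Perm (Fin (N + 1))) (D : Finset (Fin N)) (x : Fin (N + 1)) :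
    ((mk σ D).f x : ℕ) = cnt D (σ.symm x) := rfl

theorem srt_mk (σ : Equiv.Perm (Fin (N + 1))) (D : Finset (Fin N))
    (h : ∀ i, Desc σ i → i ∈ D) : srt (mk σ D) = σ := by
  symm
  refine Tuple.eq_sort_iff.mpr ⟨?_, ?_⟩
  · intro i j hij
    rw [Fin.le_def]
    simp only [Function.comp, mk_f, Equiv.symm_apply_apply]
    exact cnt_mono D hij
  · intro i j
    rw [Fin.ext_iff]
    simp only [mk_f, Equiv.symm_apply_apply]
    induction j using Fin.induction with
    | zero => intro h; exact absurd h (Fin.not_lt_zero i)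
    | succ j ih =>
      intro hij hc
      have h1 : i ≤ j.castSucc := Fin.le_castSucc_iff.mpr hij
      have h2 := cnt_mono D h1
      have h3 := cnt_succ D j
      have hj : j ∉ D := by
        intro hj
        rw [if_pos hj] at h3
        omega
      rw [if_neg hj] at h3
      have h4 : σ j.castSucc < σ j.succ := by
        have : ¬ Desc σ j := fun hd => hj (h j hd)
        refine lt_of_le_of_ne (not_lt.mp this) fun he => ?_
        exact absurd (σ.injective he) (Fin.castSucc_lt_succ (i := j)).ne
      rcases h1.eq_or_lt with h5 | h5
      · rw [h5]; exact h4
      · exact (ih h5 (by omega)).trans h4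

theorem cuts_mk (σ : Equiv.Perm (Fin (N + 1))) (D : Finset (Fin N))
    (h : ∀ i, Desc σ i → i ∈ D) : cuts (mk σ D) = D := by
  ext i
  simp only [cuts, srt_mk σ D h, Finset.mem_filter, Finset.mem_univ, true_and, Fin.lt_def, mk_f,
    Equiv.symm_apply_apply]
  rw [cnt_succ]
  split_ifs with h <;> simp [h]

theorem sum_eq (T : Equiv.Perm (Fin (N + 1)) → Finset (Fin N) → RatFunc ℚ) :
    ∑ o : Surjs (N + 1), T (srt o) (cuts o)
      = ∑ σ, ∑ D ∈ Finset.univ.filter (fun D : Finset (Fin N) => ∀ i, Desc σ i → i ∈ D),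
          T σ D := by
  rw [Finset.sum_sigma']
  refine Finset.sum_bij (fun o _ => ⟨srt o, cuts o⟩) ?_ ?_ ?_ ?_
  · intro o _
    simpa using desc_cuts o
  · intro o _ o' _ h
    simp only [Sigma.mk.injEq, heq_eq_eq] at h
    apply surj_ext
    · rw [k_eq, k_eq, h.2]
    · intro x
      have h1 := f_srt o ((srt o).symm x)
      have h2 := f_srt o' ((srt o').symm x)
      rw [Equiv.apply_symm_apply] at h1 h2
      rw [h1, h2, h.1, h.2]
  · rintro ⟨σ, D⟩ h
    have h' : ∀ i, Desc σ i → i ∈ D := by simpa using h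
    exact ⟨mk σ D, Finset.mem_univ _, by rw [srt_mk σ D h', cuts_mk σ D h']⟩
  · intro o _
    rfl

theorem sum_cuts (y : Fin N → RatFunc ℚ) (P : Fin N → Prop) :
    ∑ D ∈ Finset.univ.filter (fun D : Finset (Fin N) => ∀ i, P i → i ∈ D), ∏ d ∈ D, y d
      = ∏ i, (if P i then y i else 1 + y i) := by
  have h1 : ∀ i, (if P i then y i else 1 + y i) = y i + (if P i then 0 else 1) := by
    intro i
    split_ifs <;> ring
  simp_rw [h1]
  rw [Finset.prod_add, Finset.sum_filter, Finset.powerset_univ]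
  refine Finset.sum_congr rfl fun D _ => ?_
  split_ifs with h
  · rw [Finset.prod_eq_one (s := Finset.univ \ D), mul_one]
    intro i hi
    rw [if_neg]
    intro hp
    simp at hi
    exact hi (h i hp)
  · push Not at h
    obtain ⟨i, hi, hiD⟩ := h
    rw [Finset.prod_eq_zero (i := i) (s := Finset.univ \ D) (by simp [hiD]) (by simp [hi]),
      mul_zero]

theorem F_eq (m : Fin (N + 1) → Fin (N + 1) → ℕ) (g : Finset (Fin (N + 1)) → RatFunc ℚ) :
    ∑ o : Surjs (N + 1), (∏ i ∈ Finset.range (o.k - 1), g (lowSet o i))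
        * RatFunc.X ^ (-(wgt m o))
      = ∑ σ : Equiv.Perm (Fin (N + 1)),
        (∏ i, (if Desc σ i then g (low σ i) else 1 + g (low σ i))) * RatFunc.X ^ (-(pw m σ)) := by
  simp_rw [prod_eq, wgt_eq]
  rw [sum_eq (fun σ D => (∏ d ∈ D, g (low σ d)) * RatFunc.X ^ (-(pw m σ)))]
  refine Finset.sum_congr rfl fun σ _ => ?_
  rw [← Finset.sum_mul, sum_cuts]

theorem cut_compl {n : ℕ} (e : Fin n → Fin n → ℕ) (hsymm : ∀ a b, e a b = e b a)
    (S : Finset (Fin n)) : cut e Sᶜ = cut e S := by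
  unfold cut
  rw [compl_compl, Finset.sum_comm]
  simp_rw [fun a b => hsymm b a]

theorem low_rev (σ : Equiv.Perm (Fin (N + 1))) (i : Fin N) :
    low (Fin.revPerm.trans σ) i = (low σ i.rev)ᶜ := by
  ext x
  simp only [low, Finset.mem_compl, Finset.mem_filter, Finset.mem_univ, true_and, Fin.le_def,
    Equiv.symm_trans_apply, Fin.revPerm_symm, Fin.revPerm_apply, Fin.val_rev, Fin.val_castSucc]
  have := i.isLt
  have := (σ.symm x).isLt
  omega

theorem desc_rev (σ : Equiv.Perm (Fin (N + 1))) (i : Fin N) :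
    Desc (Fin.revPerm.trans σ) i ↔ ¬ Desc σ i.rev := by
  simp only [Desc, Equiv.trans_apply, Fin.revPerm_apply, Fin.rev_succ, Fin.rev_castSucc, not_lt]
  constructor
  · exact fun h => h.le
  · intro h
    refine lt_of_le_of_ne h fun he => ?_
    exact absurd (σ.injective he) (Fin.castSucc_lt_succ (i := i.rev)).ne

theorem pw_rev (m : Fin (N + 1) → Fin (N + 1) → ℕ) (σ : Equiv.Perm (Fin (N + 1))) :
    pw m (Fin.revPerm.trans σ) = - pw m σ := by
  unfold pw
  simp_rw [← Finset.sum_neg_distrib]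
  refine Finset.sum_congr rfl fun i _ => Finset.sum_congr rfl fun j _ => ?_
  simp only [Equiv.symm_trans_apply, Fin.revPerm_symm, Fin.revPerm_apply, Fin.rev_lt_rev]
  by_cases hij : i < j
  · have hne : σ.symm i ≠ σ.symm j := fun h => hij.ne (σ.symm.injective h)
    rcases lt_or_gt_of_ne hne with h | h
    · simp [hij, h, h.asymm]
    · simp [hij, h, h.asymm]
  · simp [hij]

theorem X_pow_ne (c : ℕ) (hc : 0 < c) : (1 : RatFunc ℚ) - RatFunc.X ^ c ≠ 0 := by
  intro h
  have h1 : (RatFunc.X : RatFunc ℚ) ^ c = 1 := (sub_eq_zero.mp h).symm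
  rw [← RatFunc.algebraMap_X, ← map_pow, ← map_one (algebraMap (Polynomial ℚ) (RatFunc ℚ))] at h1
  have h2 := RatFunc.algebraMap_injective ℚ h1
  have h3 := congrArg Polynomial.natDegree h2
  simp at h3
  omega

theorem iota_y (ι : RatFunc ℚ →ₐ[ℚ] RatFunc ℚ) (hι : ι RatFunc.X = (RatFunc.X)⁻¹)
    (c : ℕ) (hc : 0 < c) :
    ι (RatFunc.X ^ c / (1 - RatFunc.X ^ c))
      = - (1 + RatFunc.X ^ c / (1 - RatFunc.X ^ c)) := by
  have h1 := X_pow_ne c hc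
  have hX : (RatFunc.X : RatFunc ℚ) ^ c ≠ 0 := pow_ne_zero _ RatFunc.X_ne_zero
  rw [map_div₀, map_sub, map_one, map_pow, hι, inv_pow]
  generalize (RatFunc.X : RatFunc ℚ) ^ c = z at *
  have h2 : z - 1 ≠ 0 := fun h => h1 (by linear_combination -h)
  have h3 : 1 - z⁻¹ ≠ 0 := by
    intro h
    apply h2
    field_simp at h
    simpa using h
  rw [div_eq_iff h3]
  field_simp
  ring

end SchemeAux

open SchemeAux in
/-- The symmetry in `D`, for a fixed unlabeled scheme with `n` scheme vertices, of the
generating series `R^b_s` of scheme-rooted pruned well-labeled well-oriented blossoming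
unicellular maps: `ι F = (−1)^{n−1} F`. -/
theorem scheme_series_symmetric_in_D (n : ℕ) (hn : 1 ≤ n)
    (e : Fin n → Fin n → ℕ) (hsymm : ∀ a b, e a b = e b a) (hconn : GraphConnected e)
    (m : Fin n → Fin n → ℕ)
    (ι : RatFunc ℚ →ₐ[ℚ] RatFunc ℚ) (hι : ι RatFunc.X = (RatFunc.X)⁻¹)
    (F : RatFunc ℚ)
    (hF : F = ∑ o : Surjs n,
        (∏ i ∈ Finset.range (o.k - 1),
            RatFunc.X ^ cut e (lowSet o i) / (1 - RatFunc.X ^ cut e (lowSet o i))) *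
          RatFunc.X ^ (-(wgt m o))) :
    ι F = (-1 : RatFunc ℚ) ^ (n - 1) * F := by
  obtain ⟨N, rfl⟩ : ∃ N, n = N + 1 := ⟨n - 1, by omega⟩
  let g : Finset (Fin (N + 1)) → RatFunc ℚ := fun S =>
    RatFunc.X ^ cut e S / (1 - RatFunc.X ^ cut e S)
  have hF' : F = ∑ σ : Equiv.Perm (Fin (N + 1)),
      (∏ i, (if Desc σ i then g (low σ i) else 1 + g (low σ i))) * RatFunc.X ^ (-(pw m σ)) := by
    rw [hF]
    exact F_eq m g
  have hpos : ∀ (σ : Equiv.Perm (Fin (N + 1))) (i : Fin N), 0 < cut e (low σ i) := by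
    intro σ i
    obtain ⟨a, ha, b, hb, hab⟩ := hconn (low σ i)
      ⟨σ i.castSucc, by simp [low]⟩ (by
        intro h
        have h1 : σ i.succ ∈ low σ i := by rw [h]; exact Finset.mem_univ _
        simp [low, Fin.le_def] at h1)
    unfold cut
    refine Finset.sum_pos' (fun _ _ => Nat.zero_le _) ⟨a, ha, ?_⟩
    exact Finset.sum_pos' (fun _ _ => Nat.zero_le _) ⟨b, hb, hab⟩
  have hg : ∀ (σ : Equiv.Perm (Fin (N + 1))) (i : Fin N),
      ι (g (low σ i)) = - (1 + g (low σ i)) := fun σ i => iota_y ι hι _ (hpos σ i)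
  have hgc : ∀ S, g Sᶜ = g S := by
    intro S
    simp only [g, cut_compl e hsymm]
  rw [hF', map_sum, Finset.mul_sum]
  let R : Equiv.Perm (Equiv.Perm (Fin (N + 1))) :=
    ⟨fun σ => Fin.revPerm.trans σ, fun σ => Fin.revPerm.trans σ,
      fun σ => by ext x; simp, fun σ => by ext x; simp⟩
  rw [← Equiv.sum_comp R (fun σ => (-1 : RatFunc ℚ) ^ (N + 1 - 1) *
    ((∏ i, (if Desc σ i then g (low σ i) else 1 + g (low σ i))) * RatFunc.X ^ (-(pw m σ))))]
  refine Finset.sum_congr rfl fun σ _ => ?_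
  change _ = (-1 : RatFunc ℚ) ^ (N + 1 - 1) *
    ((∏ i, (if Desc (Fin.revPerm.trans σ) i then g (low (Fin.revPerm.trans σ) i)
      else 1 + g (low (Fin.revPerm.trans σ) i))) * RatFunc.X ^ (-(pw m (Fin.revPerm.trans σ))))
  rw [pw_rev, neg_neg, map_mul, map_zpow₀, hι, inv_zpow', neg_neg, ← mul_assoc]
  congr 1
  simp_rw [low_rev, desc_rev, hgc]
  have hrev : ∏ i : Fin N, (if ¬ Desc σ i.rev then g (low σ i.rev) else 1 + g (low σ i.rev))
      = ∏ i : Fin N, (if ¬ Desc σ i then g (low σ i) else 1 + g (low σ i)) :=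
    Equiv.prod_comp Fin.revPerm (fun i => if ¬ Desc σ i then g (low σ i) else 1 + g (low σ i))
  rw [hrev, map_prod]
  have hc : (-1 : RatFunc ℚ) ^ (N + 1 - 1) = ∏ _i : Fin N, (-1 : RatFunc ℚ) := by simp
  rw [hc, ← Finset.prod_mul_distrib]
  refine Finset.prod_congr rfl fun i _ => ?_
  by_cases h : Desc σ i
  · simp only [h, if_true, not_true, if_false, hg]
    ring
  · simp only [h, if_true, not_false_eq_true, if_false, map_add, map_one, hg]
    ring
end
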